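/- Let v be a standard monomial of degree d in R_n, and define its dual v* := ∏_{i ∈ {1,…,n} ∖ (A_v ∪ B_v)} a_i · b(v), which is a standard monomial of degree n − d with A_{v*} = {1,…,n} ∖ (A_v ∪ B_v) and B_{v*} = B_v. Then v** = v, and v·v* = (−2)^{|B_v|/2} · a_1⋯a_n, which is a nonzero element of R_n^n. -/

import Mathlib

open MvPolynomial

namespace TautCt

/-- The polynomial ring ℚ[a_i, b_{jk}] with variables `a i` for `i : Fin n` and
`b s` for `s` an off-diagonal unordered pair of elements of `Fin n`. -/
abbrev Pn (n : ℕ) : Type := MvPolynomial (Fin n ⊕ {s : Sym2 (Fin n) // ¬ s.IsDiag}) ℚ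

/-- The generator `a_i`. -/
noncomputable def aP (n : ℕ) (i : Fin n) : Pn n := X (Sum.inl i)

/-- The generator `b_s` for an unordered pair `s` (junk value `0` on the diagonal). -/
noncomputable def bS (n : ℕ) (s : Sym2 (Fin n)) : Pn n :=
  if h : s.IsDiag then 0 else X (Sum.inr ⟨s, h⟩)

/-- The generator `b_{i,j} = b_{j,i}`. -/
noncomputable def bP (n : ℕ) (i j : Fin n) : Pn n := bS n s(i, j)

/-- The defining relations of the tautological ring `R_n`. -/
def relSet (n : ℕ) : Set (Pn n) :=
  { x | (∃ i, x = aP n i ^ 2) ∨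
        (∃ i j, i ≠ j ∧ x = aP n i * bP n i j) ∨
        (∃ i j, i ≠ j ∧ x = bP n i j ^ 2 + 2 * (aP n i * aP n j)) ∨
        (∃ i j k, i ≠ j ∧ i ≠ k ∧ j ≠ k ∧
          x = bP n i j * bP n i k - aP n i * bP n j k) ∨
        (∃ i j k l, i ≠ j ∧ i ≠ k ∧ i ≠ l ∧ j ≠ k ∧ j ≠ l ∧ k ≠ l ∧
          x = bP n i j * bP n k l + bP n i k * bP n j l + bP n i l * bP n j k) }

noncomputable def relIdeal (n : ℕ) : Ideal (Pn n) := Ideal.span (relSet n)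

/-- The tautological ring `R_n = R^*(C^n)`. -/
abbrev Rn (n : ℕ) : Type := Pn n ⧸ relIdeal n

noncomputable def mkR (n : ℕ) : Pn n →ₐ[ℚ] Rn n := Ideal.Quotient.mkₐ ℚ (relIdeal n)

/-- The degree-`d` graded piece `R_n^d`: the image of the homogeneous degree-`d`
polynomials under the quotient map. -/
noncomputable def Rgrade (n d : ℕ) : Submodule ℚ (Rn n) :=
  (homogeneousSubmodule (Fin n ⊕ {s : Sym2 (Fin n) // ¬ s.IsDiag}) ℚ d).map
    (mkR n).toLinearMap

/-- `M` is a perfect matching of the subset `B ⊆ {1,…,n}`. -/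
def IsMatching (n : ℕ) (B : Finset (Fin n)) (M : Finset (Sym2 (Fin n))) : Prop :=
  (∀ s ∈ M, ¬ s.IsDiag) ∧
  (∀ s ∈ M, ∀ t ∈ M, s ≠ t → ∀ a : Fin n, a ∈ s → a ∉ t) ∧
  (∀ a : Fin n, a ∈ B ↔ ∃ s ∈ M, a ∈ s)

/-- The standard monomial `∏_{i ∈ A} a_i · ∏_{{j,k} ∈ M} b_{j,k}`. -/
noncomputable def stdMon (n : ℕ) (A : Finset (Fin n)) (M : Finset (Sym2 (Fin n))) : Pn n :=
  (∏ i ∈ A, aP n i) * ∏ s ∈ M, bS n s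

section Exterior

variable {V : Type*} [AddCommGroup V] [Module ℚ V]

open ExteriorAlgebra in
lemma ι_mul_ι_swap (u v : V) : ι ℚ u * ι ℚ v = -(ι ℚ v * ι ℚ u) :=
  eq_neg_of_add_eq_zero_left (ι_add_mul_swap u v)

/-- Products of two vectors in the exterior algebra. -/
def bivectors (V : Type*) [AddCommGroup V] [Module ℚ V] : Set (ExteriorAlgebra ℚ V) :=
  Set.range fun p : V × V => ExteriorAlgebra.ι ℚ p.1 * ExteriorAlgebra.ι ℚ p.2

open ExteriorAlgebra in
lemma ι_commute_bivector (u v w : V) : Commute (ι ℚ u) (ι ℚ v * ι ℚ w) := by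
  rw [commute_iff_eq, ← mul_assoc, ι_mul_ι_swap u v, neg_mul, mul_assoc, ι_mul_ι_swap u w,
    mul_neg, neg_neg, mul_assoc]

lemma bivectors_comm : ∀ a ∈ bivectors V, ∀ b ∈ bivectors V, a * b = b * a := by
  rintro _ ⟨⟨u, v⟩, rfl⟩ _ ⟨⟨w, z⟩, rfl⟩
  exact (ι_commute_bivector u w z).mul_left (ι_commute_bivector v w z)

/-- The (commutative) subalgebra of the exterior algebra generated by bivectors. -/
abbrev EvenAlg (V : Type*) [AddCommGroup V] [Module ℚ V] : Type _ :=
  Algebra.adjoin ℚ (bivectors V)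

noncomputable instance : CommRing (EvenAlg V) :=
  { (inferInstance : Ring (EvenAlg V)) with
    mul_comm := (Algebra.isMulCommutative_adjoin ℚ bivectors_comm).is_comm.comm }

/-- The product of two vectors as an element of `EvenAlg V`. -/
noncomputable def wedge (u v : V) : EvenAlg V :=
  ⟨ExteriorAlgebra.ι ℚ u * ExteriorAlgebra.ι ℚ v, Algebra.subset_adjoin ⟨(u, v), rfl⟩⟩

lemma wedge_self (u : V) : wedge u u = 0 :=
  Subtype.ext (ExteriorAlgebra.ι_sq_zero u)

lemma wedge_swap (u v : V) : wedge u v = -wedge v u :=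
  Subtype.ext (ι_mul_ι_swap u v)

lemma wedge_mul_wedge (u v w z : V) : wedge u v * wedge w z = -(wedge u w * wedge v z) := by
  apply Subtype.ext
  change ExteriorAlgebra.ι ℚ u * ExteriorAlgebra.ι ℚ v *
      (ExteriorAlgebra.ι ℚ w * ExteriorAlgebra.ι ℚ z) =
    -(ExteriorAlgebra.ι ℚ u * ExteriorAlgebra.ι ℚ w *
      (ExteriorAlgebra.ι ℚ v * ExteriorAlgebra.ι ℚ z))
  rw [mul_assoc, ← mul_assoc (ExteriorAlgebra.ι ℚ v), ι_mul_ι_swap v w]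
  simp only [neg_mul, mul_neg, mul_assoc]

lemma wedge_mul_wedge_left (u v w : V) : wedge u v * wedge u w = 0 := by
  rw [wedge_mul_wedge, wedge_self, zero_mul, neg_zero]

lemma wedge_mul_wedge_right (u v w : V) : wedge v u * wedge w u = 0 := by
  rw [wedge_swap v u, wedge_swap w u, neg_mul_neg, wedge_mul_wedge_left]

end Exterior

section Model

variable {n : ℕ}

/-- The first basis vector attached to the `i`-th factor. -/
def vecX (i : Fin n) : Fin (n * 2) → ℚ := Pi.single (finProdFinEquiv (i, 0)) 1

/-- The second basis vector attached to the `i`-th factor. -/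
def vecY (i : Fin n) : Fin (n * 2) → ℚ := Pi.single (finProdFinEquiv (i, 1)) 1

/-- The class of `b_{i,j}` in the exterior algebra model. -/
noncomputable def modelB (i j : Fin n) : EvenAlg (Fin (n * 2) → ℚ) :=
  -(wedge (vecX i) (vecY j) + wedge (vecX j) (vecY i))

/-- Evaluation of polynomials in the exterior algebra, the cohomology of a power of an
elliptic curve. -/
noncomputable def modelHom (n : ℕ) : Pn n →ₐ[ℚ] EvenAlg (Fin (n * 2) → ℚ) :=
  aeval (Sum.elim (fun i => wedge (vecX i) (vecY i))
    (fun s => Sym2.lift ⟨modelB, fun i j => by simp only [modelB, add_comm]⟩ s.1))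

@[simp]
lemma modelHom_aP (i : Fin n) : modelHom n (aP n i) = wedge (vecX i) (vecY i) := by
  simp [modelHom, aP]

lemma modelHom_bP {i j : Fin n} (h : i ≠ j) : modelHom n (bP n i j) = modelB i j := by
  simp [modelHom, bP, bS, h]

lemma modelHom_eq_zero_of_mem_relSet {x : Pn n} (hx : x ∈ relSet n) : modelHom n x = 0 := by
  rcases hx with ⟨i, rfl⟩ | ⟨i, j, hij, rfl⟩ | ⟨i, j, hij, rfl⟩ | ⟨i, j, k, hij, hik, hjk, rfl⟩ |
    ⟨i, j, k, l, hij, hik, hil, hjk, hjl, hkl, rfl⟩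
  · rw [map_pow, modelHom_aP, pow_two, wedge_mul_wedge_left]
  · rw [map_mul, modelHom_aP, modelHom_bP hij, modelB]
    linear_combination -wedge_mul_wedge_left (vecX i) (vecY i) (vecY j) -
      wedge_mul_wedge_right (vecY i) (vecX i) (vecX j)
  · simp only [map_add, map_mul, map_pow, map_ofNat, modelHom_aP, modelHom_bP hij, modelB]
    have h := wedge_mul_wedge (vecX i) (vecY j) (vecY i) (vecX j)
    rw [wedge_swap (vecY i) (vecX j), wedge_swap (vecY j) (vecX j)] at h
    linear_combination wedge_mul_wedge_left (vecX i) (vecY j) (vecY j) +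
      wedge_mul_wedge_left (vecX j) (vecY i) (vecY i) - 2 * h
  · simp only [map_sub, map_mul, modelHom_aP, modelHom_bP hij, modelHom_bP hik,
      modelHom_bP hjk, modelB]
    have h₁ := wedge_mul_wedge (vecX i) (vecY j) (vecY i) (vecX k)
    have h₂ := wedge_mul_wedge (vecX i) (vecY k) (vecY i) (vecX j)
    rw [wedge_swap (vecY i) (vecX k), wedge_swap (vecY j) (vecX k)] at h₁
    rw [wedge_swap (vecY i) (vecX j), wedge_swap (vecY k) (vecX j)] at h₂
    linear_combination wedge_mul_wedge_left (vecX i) (vecY j) (vecY k) +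
      wedge_mul_wedge_right (vecY i) (vecX j) (vecX k) - h₁ - h₂
  · simp only [map_add, map_mul, modelHom_bP hij, modelHom_bP hik, modelHom_bP hil,
      modelHom_bP hjk, modelHom_bP hjl, modelHom_bP hkl, modelB]
    have key : ∀ p q r s : Fin n, wedge (vecX p) (vecY q) * wedge (vecX r) (vecY s) =
        -(wedge (vecX p) (vecY s) * wedge (vecX r) (vecY q)) := by
      intro p q r s
      have h := wedge_mul_wedge (vecX p) (vecY q) (vecY s) (vecX r)
      rw [wedge_swap (vecY s) (vecX r), wedge_swap (vecY q) (vecX r)] at h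
      linear_combination -h
    linear_combination key i j k l + key i j l k + key j i k l + key j i l k +
      key i k j l + key k i l j

lemma modelHom_eq_zero_of_mem {x : Pn n} (hx : x ∈ relIdeal n) : modelHom n x = 0 := by
  have h : relIdeal n ≤ RingHom.ker (modelHom n) :=
    Ideal.span_le.2 fun _ hy => modelHom_eq_zero_of_mem_relSet hy
  exact h hx

lemma coe_prod_wedge :
    ((∏ i : Fin n, wedge (vecX i) (vecY i) : EvenAlg (Fin (n * 2) → ℚ)) :
      ExteriorAlgebra ℚ (Fin (n * 2) → ℚ)) =
    ExteriorAlgebra.ιMulti ℚ (n * 2) fun i => Pi.single i 1 := by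
  rw [ExteriorAlgebra.ιMulti_apply, List.ofFn_mul, List.prod_flatten, List.map_ofFn,
    ← List.prod_ofFn, ← Subalgebra.coe_val, map_list_prod, List.map_ofFn]
  congr 2
  funext i
  simp [wedge, vecX, vecY, finProdFinEquiv, mul_comm, add_comm]

lemma modelHom_prod_aP_ne_zero : modelHom n (∏ i, aP n i) ≠ 0 := by
  intro h
  have h' := congrArg Subtype.val h
  simp only [map_prod, modelHom_aP] at h'
  rw [coe_prod_wedge, ZeroMemClass.coe_zero] at h'
  have h₁ := congrArg (ExteriorAlgebra.liftAlternating (R := ℚ)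
    (Function.update 0 (n * 2) (Pi.basisFun ℚ (Fin (n * 2))).det)) h'
  rw [ExteriorAlgebra.liftAlternating_apply_ιMulti, Function.update_self, map_zero] at h₁
  have h₂ := (Pi.basisFun ℚ (Fin (n * 2))).det_self
  rw [show (⇑(Pi.basisFun ℚ (Fin (n * 2)))) = fun i => Pi.single i 1 from
    funext fun i => Pi.basisFun_apply ℚ _ i, h₁] at h₂
  exact zero_ne_one h₂

lemma mkR_prod_aP_ne_zero : mkR n (∏ i, aP n i) ≠ 0 := fun h =>
  modelHom_prod_aP_ne_zero (modelHom_eq_zero_of_mem (Ideal.Quotient.eq_zero_iff_mem.1 h))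

end Model

section Matching

variable {n : ℕ} {B : Finset (Fin n)} {M : Finset (Sym2 (Fin n))}

lemma IsMatching.eq_biUnion (hM : IsMatching n B M) : B = M.biUnion Sym2.toFinset := by
  ext a
  simp [hM.2.2 a]

lemma IsMatching.pairwiseDisjoint (hM : IsMatching n B M) :
    (M : Set (Sym2 (Fin n))).PairwiseDisjoint Sym2.toFinset := fun s hs t ht hst =>
  Finset.disjoint_left.2 fun a has hat =>
    hM.2.1 s hs t ht hst a (Sym2.mem_toFinset.1 has) (Sym2.mem_toFinset.1 hat)

lemma IsMatching.card_eq (hM : IsMatching n B M) : B.card = 2 * M.card := by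
  rw [hM.eq_biUnion, Finset.card_biUnion hM.pairwiseDisjoint,
    Finset.sum_congr rfl fun s hs => Sym2.card_toFinset_of_not_isDiag s (hM.1 s hs),
    Finset.sum_const, smul_eq_mul, mul_comm]

lemma smul_eq_algebraMap_mul (q : ℚ) (x : Rn n) : q • x = algebraMap ℚ (Rn n) q * x :=
  Algebra.smul_def q x

lemma mkR_bS_sq {s : Sym2 (Fin n)} (hs : ¬ s.IsDiag) :
    mkR n (bS n s) ^ 2 = (-2 : ℚ) • ∏ i ∈ s.toFinset, mkR n (aP n i) := by
  induction s using Sym2.ind with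
  | _ i j =>
    have hij : i ≠ j := by simpa using hs
    have h : mkR n (bP n i j ^ 2 + 2 * (aP n i * aP n j)) = 0 :=
      Ideal.Quotient.eq_zero_iff_mem.2
        (Ideal.subset_span (Or.inr (Or.inr (Or.inl ⟨i, j, hij, rfl⟩))))
    rw [Sym2.toFinset_mk_eq, Finset.prod_pair hij, smul_eq_algebraMap_mul]
    simp only [map_add, map_mul, map_pow, map_ofNat, map_neg] at h ⊢
    rw [← bP]
    linear_combination h

lemma IsMatching.mkR_prod_bS_sq (hM : IsMatching n B M) :
    mkR n (∏ s ∈ M, bS n s) ^ 2 = (-2 : ℚ) ^ (B.card / 2) • mkR n (∏ i ∈ B, aP n i) := by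
  rw [hM.card_eq, Nat.mul_div_cancel_left _ two_pos, hM.eq_biUnion,
    Finset.prod_biUnion hM.pairwiseDisjoint]
  simp only [map_prod, ← Finset.prod_pow]
  rw [Finset.prod_congr rfl fun s hs => mkR_bS_sq (hM.1 s hs), Finset.prod_smul,
    Finset.prod_const]

end Matching

/-- Let `v` be a standard monomial of degree `d` in `R_n`, with
`A_v = A`, `B_v = B` and matching `M`. Its dual
`v* = ∏_{i ∈ {1,…,n} ∖ (A ∪ B)} a_i · b(v)` is a standard monomial of degree `n - d`
with `A_{v*} = {1,…,n} ∖ (A ∪ B)` and `B_{v*} = B`; moreover `v** = v` and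
`v·v* = (-2)^{|B|/2} · a_1⋯a_n`, a nonzero element of `R_n^n`. -/
theorem dual_standard_monomial (n : ℕ) (hn : 1 ≤ n) (d : ℕ)
    (A B : Finset (Fin n)) (M : Finset (Sym2 (Fin n)))
    (hAB : Disjoint A B) (hM : IsMatching n B M)
    (hd : A.card + B.card / 2 = d) :
    -- `v*` is a standard monomial of degree `n - d`:
    Disjoint (Finset.univ \ (A ∪ B)) B ∧
    (Finset.univ \ (A ∪ B)).card + B.card / 2 = n - d ∧
    -- `v** = v`:
    Finset.univ \ ((Finset.univ \ (A ∪ B)) ∪ B) = A ∧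
    -- `v·v* = (-2)^{|B|/2} · a_1⋯a_n`:
    mkR n (stdMon n A M) * mkR n (stdMon n (Finset.univ \ (A ∪ B)) M)
      = ((-2 : ℚ) ^ (B.card / 2)) • mkR n (∏ i, aP n i) ∧
    -- which is a nonzero element of `R_n^n`:
    ((-2 : ℚ) ^ (B.card / 2)) • mkR n (∏ i, aP n i) ≠ 0 := by
  have hdisj : Disjoint (Finset.univ \ (A ∪ B)) B :=
    Finset.disjoint_left.2 fun i hi hB =>
      (Finset.mem_sdiff.1 hi).2 (Finset.mem_union_right _ hB)
  have hprod : ∏ i, aP n i = (∏ i ∈ Finset.univ \ (A ∪ B), aP n i) *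
      ((∏ i ∈ A, aP n i) * ∏ i ∈ B, aP n i) := by
    rw [← Finset.prod_union hAB, Finset.prod_sdiff (Finset.subset_univ _)]
  refine ⟨hdisj, ?_, ?_, ?_, smul_ne_zero (pow_ne_zero _ (by norm_num)) mkR_prod_aP_ne_zero⟩
  · have h₁ := Finset.card_sdiff_add_card_eq_card (Finset.subset_univ (A ∪ B))
    rw [Finset.card_union_of_disjoint hAB, Finset.card_univ, Fintype.card_fin] at h₁
    have h₂ := hM.card_eq
    omega
  · ext i
    have : i ∈ A → i ∉ B := fun h => Finset.disjoint_left.1 hAB h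
    simp only [Finset.mem_sdiff, Finset.mem_union, Finset.mem_univ, true_and]
    tauto
  · rw [hprod, stdMon, stdMon]
    have h := hM.mkR_prod_bS_sq
    rw [smul_eq_algebraMap_mul] at h ⊢
    simp only [map_mul] at h ⊢
    linear_combination (mkR n (∏ i ∈ A, aP n i) *
      mkR n (∏ i ∈ Finset.univ \ (A ∪ B), aP n i)) * h

end TautCt
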